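/- Let q be a prime power, let Y ⊆ F_q \ {0}, and let C ⊆ F_q. Then Σ_{y ∈ Y} E^+(C, yC) ≤ |C|^4 |Y| / q + q |C|^2. -/

import Mathlib

/-- `addEnergy2 A B` is `E^+(A, B) = #{(a, b, a', b') ∈ A × B × A × B : a + b = a' + b'}`. -/
noncomputable def addEnergy2 {F : Type*} [Add F] (A B : Set F) : ℕ :=
  {t : F × F × F × F | t.1 ∈ A ∧ t.2.1 ∈ B ∧ t.2.2.1 ∈ A ∧ t.2.2.2 ∈ B ∧
      t.1 + t.2.1 = t.2.2.1 + t.2.2.2}.ncard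

/-- `addEnergy C` is the additive energy `E^+(C) = E^+(C, C)`. -/
noncomputable def addEnergy {F : Type*} [Add F] (C : Set F) : ℕ := addEnergy2 C C

open Finset in
/-- The number of coincidences of a map is at least its average value. -/
theorem card_sq_le_card_mul_card_coincidences {α β : Type*} [Fintype β] [DecidableEq β]
    (s : Finset α) (f : α → β) :
    #s ^ 2 ≤ Fintype.card β * #{p ∈ s ×ˢ s | f p.1 = f p.2} := by
  have hs : #s = ∑ b, #{a ∈ s | f a = b} :=
    card_eq_sum_card_fiberwise fun _ _ => mem_univ _
  have hc : #{p ∈ s ×ˢ s | f p.1 = f p.2} = ∑ b, #{a ∈ s | f a = b} ^ 2 := by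
    rw [card_eq_sum_card_fiberwise (f := fun p => f p.1) (t := univ) fun _ _ => mem_univ _]
    refine sum_congr rfl fun b _ => ?_
    rw [sq, ← card_product]
    congr 1
    ext p
    simp only [mem_filter, mem_product]
    grind
  rw [hs, hc]
  exact sq_sum_le_card_mul_sum_sq

open Finset in
/-- Two distinct points of the plane agree under `p ↦ p.1 + y * p.2` for at most one `y`. -/
theorem card_slopes_le {F : Type*} [Field F] [Fintype F] [DecidableEq F] (p : (F × F) × F × F) :
    #{y : F | p.1.1 + y * p.1.2 = p.2.1 + y * p.2.2} ≤
      (if p.1 = p.2 then Fintype.card F else 0) + 1 := by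
  split_ifs with h
  · exact (card_le_univ _).trans (Nat.le_succ _)
  · rw [zero_add, card_le_one]
    intro y hy z hz
    simp only [mem_filter, mem_univ, true_and] at hy hz
    by_contra hyz
    have h2 : p.1.2 = p.2.2 := by
      have : (y - z) * (p.1.2 - p.2.2) = 0 := by linear_combination hy - hz
      exact sub_eq_zero.mp ((mul_eq_zero.mp this).resolve_left (sub_ne_zero.mpr hyz))
    rw [h2] at hy
    exact h (Prod.ext (add_right_cancel hy) h2)

open Finset in
/-- Summing the number of coincidences of `p ↦ p.1 + y * p.2` over all slopes `y`. -/
theorem sum_card_coincidences_le {F : Type*} [Field F] [Fintype F] [DecidableEq F]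
    (s : Finset (F × F)) :
    ∑ y : F, #{p ∈ s ×ˢ s | p.1.1 + y * p.1.2 = p.2.1 + y * p.2.2} ≤
      Fintype.card F * #s + #s ^ 2 := by
  calc ∑ y : F, #{p ∈ s ×ˢ s | p.1.1 + y * p.1.2 = p.2.1 + y * p.2.2}
      = ∑ p ∈ s ×ˢ s, #{y : F | p.1.1 + y * p.1.2 = p.2.1 + y * p.2.2} := by
        simp only [card_filter]
        exact sum_comm
    _ ≤ ∑ p ∈ s ×ˢ s, ((if p.1 = p.2 then Fintype.card F else 0) + 1) :=
        sum_le_sum fun p _ => card_slopes_le p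
    _ = Fintype.card F * #s + #s ^ 2 := by
        rw [sum_add_distrib, sum_product]
        simp [sq, mul_comm]

open Finset in
/-- The energy `E^+(C, yC)` counts the coincidences of `p ↦ p.1 + y * p.2` on `C × C`. -/
theorem addEnergy2_dilate {F : Type*} [Field F] [DecidableEq F] (C : Finset F) {y : F}
    (hy : y ≠ 0) :
    addEnergy2 (C : Set F) ((fun x => y * x) '' C) =
      #{p ∈ (C ×ˢ C) ×ˢ C ×ˢ C | p.1.1 + y * p.1.2 = p.2.1 + y * p.2.2} := by
  rw [addEnergy2, ← Set.ncard_coe_finset]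
  symm
  refine Set.ncard_congr (fun p _ => (p.1.1, y * p.1.2, p.2.1, y * p.2.2)) ?_ ?_ ?_
  · rintro ⟨⟨a, b⟩, a', b'⟩ h
    simp only [coe_filter, mem_product, Set.mem_ofPred_eq] at h
    exact ⟨h.1.1.1, ⟨b, h.1.1.2, rfl⟩, h.1.2.1, ⟨b', h.1.2.2, rfl⟩, h.2⟩
  · rintro ⟨⟨a, b⟩, a', b'⟩ ⟨⟨c, d⟩, c', d'⟩ _ _ h
    simpa [hy, and_assoc] using h
  · rintro ⟨a, _, a', _⟩ ⟨ha, ⟨b, hb, rfl⟩, ha', ⟨b', hb', rfl⟩, h⟩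
    refine ⟨((a, b), a', b'), ?_, rfl⟩
    simp only [coe_filter, mem_product, Set.mem_ofPred_eq]
    exact ⟨⟨⟨ha, hb⟩, ha', hb'⟩, h⟩

/-- the Bourgain–Katz–Tao type energy bound:
$\sum_{y \in Y} E^+(C, yC) \le |C|^4 |Y| / q + q |C|^2$ for $Y \subseteq F_q \setminus \{0\}$. -/
theorem statement13 (F : Type) [Field F] [Fintype F] (Y : Finset F) (C : Set F)
    (hY : (0 : F) ∉ Y) :
    (∑ y ∈ Y, (addEnergy2 C ((fun x => y * x) '' C) : ℝ)) ≤
      (C.ncard : ℝ) ^ (4 : ℕ) * (Y.card : ℝ) / (Fintype.card F : ℝ) +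
        (Fintype.card F : ℝ) * (C.ncard : ℝ) ^ (2 : ℕ) := by
  classical
  lift C to Finset F using C.toFinite
  rw [Set.ncard_coe_finset]
  set n : ℝ := (C.card : ℝ)
  set q : ℝ := (Fintype.card F : ℝ)
  have hq : 0 < q := Nat.cast_pos.mpr Fintype.card_pos
  let N (y : F) : ℕ := (((C ×ˢ C) ×ˢ C ×ˢ C).filter
    fun p => p.1.1 + y * p.1.2 = p.2.1 + y * p.2.2).card
  have hN (y : F) : 0 ≤ (N y : ℝ) - n ^ 4 / q := by
    have h : ((C ×ˢ C).card : ℝ) ^ 2 ≤ q * N y := by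
      unfold q
      exact_mod_cast card_sq_le_card_mul_card_coincidences (C ×ˢ C) fun p : F × F => p.1 + y * p.2
    rw [Finset.card_product, Nat.cast_mul] at h
    rw [sub_nonneg, div_le_iff₀ hq]
    linear_combination h
  have htotal : ∑ y, (N y : ℝ) ≤ q * n ^ 2 + n ^ 4 := by
    have h : ∑ y, (N y : ℝ) ≤ q * (C ×ˢ C).card + ((C ×ˢ C).card : ℝ) ^ 2 := by
      unfold q
      exact_mod_cast sum_card_coincidences_le (C ×ˢ C)
    rw [Finset.card_product, Nat.cast_mul] at h
    linear_combination h
  have hdev : ∑ y ∈ Y, ((N y : ℝ) - n ^ 4 / q) ≤ ∑ y, ((N y : ℝ) - n ^ 4 / q) :=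
    Finset.sum_le_sum_of_subset_of_nonneg Y.subset_univ fun y _ _ => hN y
  simp only [Finset.sum_sub_distrib, Finset.sum_const, nsmul_eq_mul, Finset.card_univ] at hdev
  rw [mul_div_cancel₀ (n ^ 4) hq.ne'] at hdev
  have hE : ∑ y ∈ Y, (addEnergy2 (C : Set F) ((fun x => y * x) '' C) : ℝ) = ∑ y ∈ Y, (N y : ℝ) :=
    Finset.sum_congr rfl fun y hy =>
      congrArg _ (addEnergy2_dilate C (ne_of_mem_of_not_mem hy hY))
  rw [hE]
  linear_combination hdev + htotal
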